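/- Let 2 ≤ k ≤ n and α, K₀, N₀, N₁, C > 0. There exist positive constants m, A, B, M, L and Λ such that for every λ ∈ Γ_{k−1} with λ₁ ≥ λ₂ ≥ ⋯ ≥ λ_n ≥ −K₀, N₀ ≤ σ_k(λ) + ασ_{k−1}(λ) ≤ N₁, and λ₁ ≥ Λ, one has (B/2)·Σ_{i=1}^n S_k^{ii}(λ) + min{0, C·[M²/(mL²) + A²/m + B²/(mλ₁²)]·(S_k(λ) − κ₁ S_k^{11}(λ))·λ₁} ≥ 0, where κ₁ = λ₁ + K₀. -/

import Mathlib

open scoped BigOperators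

noncomputable section

/-- The `j`-th elementary symmetric function of the entries of `lam` indexed by `T`
(`j : ℤ`, with value `0` for `j < 0`). -/
def sigmaOn {n : ℕ} (T : Finset (Fin n)) (j : ℤ) (lam : Fin n → ℝ) : ℝ :=
  if 0 ≤ j then ∑ s ∈ T.powersetCard j.toNat, ∏ i ∈ s, lam i else 0

/-- The `j`-th elementary symmetric polynomial `σ_j(λ)`. -/
def esymmR {n : ℕ} (j : ℤ) (lam : Fin n → ℝ) : ℝ := sigmaOn Finset.univ j lam

/-- The Garding cone `Γ_k`. -/
def GammaCone (n k : ℕ) : Set (Fin n → ℝ) :=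
  {lam | ∀ i : ℕ, 1 ≤ i → i ≤ k → 0 < esymmR (i : ℤ) lam}

/-- `S_j(λ) = σ_j(λ) + α σ_{j-1}(λ)`. -/
def Sfun {n : ℕ} (α : ℝ) (j : ℤ) (lam : Fin n → ℝ) : ℝ :=
  esymmR j lam + α * esymmR (j - 1) lam

/-- The cone `Γ̃_k = Γ_{k-1} ∩ {λ : S_k(λ) > 0}`. -/
def GammaTilde (n k : ℕ) (α : ℝ) : Set (Fin n → ℝ) :=
  GammaCone n (k - 1) ∩ {lam | 0 < Sfun α (k : ℤ) lam}

/-- `S_k^{pp}(λ) = σ_{k-1}(λ|p) + α σ_{k-2}(λ|p)`, where `(λ|p)` deletes the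
`p`-th entry of `λ`. -/
def SD {n : ℕ} (α : ℝ) (k : ℤ) (lam : Fin n → ℝ) (p : Fin n) : ℝ :=
  sigmaOn (Finset.univ.erase p) (k - 1) lam + α * sigmaOn (Finset.univ.erase p) (k - 2) lam

/-- `S_k^{pp,qq}(λ) = σ_{k-2}(λ|pq) + α σ_{k-3}(λ|pq)` for `p ≠ q`, where `(λ|pq)`
deletes the `p`-th and `q`-th entries of `λ`. -/
def SDD {n : ℕ} (α : ℝ) (k : ℤ) (lam : Fin n → ℝ) (p q : Fin n) : ℝ :=
  sigmaOn ((Finset.univ.erase p).erase q) (k - 2) lam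
    + α * sigmaOn ((Finset.univ.erase p).erase q) (k - 3) lam

namespace AbsAux

open Polynomial in
lemma splits_derivative {p : ℝ[X]} (hp : p.Splits) : (derivative p).Splits := by
  rw [splits_iff_card_roots] at hp ⊢
  by_cases h0 : p.natDegree = 0
  · rw [Polynomial.derivative_of_natDegree_zero h0]; simp
  · have h1 := card_roots_le_derivative p
    have h2 := natDegree_derivative_lt h0
    have h3 := card_roots' (derivative p)
    omega

open Polynomial in
lemma splits_iter {p : ℝ[X]} (hp : p.Splits) (j : ℕ) : (derivative^[j] p).Splits := by
  induction j with
  | zero => simpa using hp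
  | succ j ih => rw [Function.iterate_succ_apply']; exact splits_derivative ih

open Polynomial in
lemma coeff_low (s : Multiset ℝ) (c : ℝ) :
    2 * ((C c * (s.map (fun a => X - C a)).prod).coeff 0
      * (C c * (s.map (fun a => X - C a)).prod).coeff 2)
      ≤ (C c * (s.map (fun a => X - C a)).prod).coeff 1 ^ 2 := by
  induction s using Multiset.induction_on with
  | empty => simp [coeff_C]
  | cons a s ih =>
    simp only [Multiset.map_cons, Multiset.prod_cons, coeff_C_mul, sub_mul, coeff_sub,
      coeff_X_mul, coeff_X_mul_zero] at ih ⊢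
    set P := (s.map (fun a => X - C a)).prod
    nlinarith [mul_nonneg (sq_nonneg a) (sub_nonneg.2 ih), sq_nonneg (c * P.coeff 0)]

open Polynomial in
lemma newton_poly {p : ℝ[X]} (hp : p.Splits) (j : ℕ) :
    p.coeff j * p.coeff (j+2) ≤ p.coeff (j+1) ^ 2 := by
  have h := splits_iter hp j
  obtain ⟨s, hs⟩ := splits_iff_exists_multiset.1 h
  have hl := coeff_low s ((derivative^[j] p).leadingCoeff)
  rw [← hs] at hl
  simp only [coeff_iterate_derivative, nsmul_eq_mul] at hl
  have e0 : (0 + j).descFactorial j = j.factorial := by simp [Nat.descFactorial_self]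
  have e1 : (1 + j).descFactorial j = (j+1) * j.factorial := by
    have := Nat.add_descFactorial_eq_ascFactorial 1 j
    have h2 := Nat.factorial_mul_descFactorial (n := 1 + j) (k := j) (by omega)
    simp at h2
    rw [h2, Nat.add_comm, Nat.factorial_succ]
  have e2 : 2 * (2 + j).descFactorial j = (j+2) * ((j+1) * j.factorial) := by
    have h2 := Nat.factorial_mul_descFactorial (n := 2 + j) (k := j) (by omega)
    simp at h2
    rw [h2, Nat.add_comm, Nat.factorial_succ, Nat.factorial_succ]
  have e2' : (2:ℝ) * ((2 + j).descFactorial j : ℝ) = (j+2) * ((j+1) * (j.factorial : ℝ)) := by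
    exact_mod_cast e2
  rw [e0, e1, Nat.add_comm 0 j, Nat.add_comm 1 j, Nat.add_comm 2 j] at hl
  rw [Nat.add_comm 2 j] at e2'
  push_cast at hl
  simp only [add_zero] at hl
  set F : ℝ := (j.factorial : ℝ)
  have hF : 0 < F := by positivity
  set a := p.coeff j
  set b := p.coeff (j+1)
  set c := p.coeff (j+2)
  have h3 : (F^2 * (j+1)) * ((j+2) * (a * c)) ≤ (F^2 * (j+1)) * ((j+1) * b^2) := by
    calc _ = F * a * ((j+2) * ((j+1) * F) * c) := by ring
      _ = 2 * (F * a * (((j + 2).descFactorial j : ℝ) * c)) := by rw [← e2']; ring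
      _ ≤ _ := hl
      _ = _ := by ring
  have h4 := le_of_mul_le_mul_left h3 (by positivity)
  by_cases hac : a * c ≤ 0
  · exact hac.trans (sq_nonneg b)
  · have : (0:ℝ) < j + 1 := by positivity
    refine le_of_mul_le_mul_left ?_ this
    nlinarith

variable {ι : Type*} [DecidableEq ι]

/-- elementary symmetric sums over a finset -/
def ee (T : Finset ι) (f : ι → ℝ) (j : ℕ) : ℝ := ∑ s ∈ T.powersetCard j, ∏ i ∈ s, f i

/-- shifted version -/
def em (T : Finset ι) (f : ι → ℝ) : ℕ → ℝ
  | 0 => 0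
  | (j+1) => ee T f j

lemma ee_zero (T : Finset ι) (f : ι → ℝ) : ee T f 0 = 1 := by simp [ee]

lemma ee_empty_succ (f : ι → ℝ) (j : ℕ) : ee (∅ : Finset ι) f (j+1) = 0 := by
  unfold ee
  rw [Finset.powersetCard_eq_empty.2 (by simp)]; simp

lemma ee_insert {T : Finset ι} {a : ι} (ha : a ∉ T) (f : ι → ℝ) (j : ℕ) :
    ee (insert a T) f (j+1) = ee T f (j+1) + f a * ee T f j := by
  unfold ee
  rw [Finset.powersetCard_succ_insert ha, Finset.sum_union, Finset.sum_image, Finset.mul_sum]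
  · congr 1
    refine Finset.sum_congr rfl fun s hs => ?_
    rw [Finset.prod_insert]
    exact fun h => ha ((Finset.mem_powersetCard.1 hs).1 h)
  · intro s hs t ht h
    have h1 : a ∉ s := fun h => ha ((Finset.mem_powersetCard.1 hs).1 h)
    have h2 : a ∉ t := fun h => ha ((Finset.mem_powersetCard.1 ht).1 h)
    rw [← Finset.erase_insert h1, ← Finset.erase_insert h2]
    exact congrArg (fun u => Finset.erase u a) h
  · rw [Finset.disjoint_left]
    intro s hs hs'
    obtain ⟨t, ht, rfl⟩ := Finset.mem_image.1 hs'
    exact ha ((Finset.mem_powersetCard.1 hs).1 (Finset.mem_insert_self a t))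

lemma ee_erase {T : Finset ι} {a : ι} (ha : a ∈ T) (f : ι → ℝ) (j : ℕ) :
    ee T f (j+1) = ee (T.erase a) f (j+1) + f a * ee (T.erase a) f j := by
  conv_lhs => rw [← Finset.insert_erase ha]
  exact ee_insert (Finset.notMem_erase a T) f j

lemma ee_erase' {T : Finset ι} {a : ι} (ha : a ∈ T) (f : ι → ℝ) (j : ℕ) :
    ee T f j = ee (T.erase a) f j + f a * em (T.erase a) f j := by
  cases j with
  | zero => simp [ee_zero, em]
  | succ j => exact ee_erase ha f j

lemma euler (T : Finset ι) (f : ι → ℝ) (j : ℕ) :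
    ∑ i ∈ T, f i * ee (T.erase i) f j = (j+1) * ee T f (j+1) := by
  induction T using Finset.induction_on generalizing j with
  | empty => simp [ee_empty_succ]
  | insert a T ha ih =>
    rw [Finset.sum_insert ha, Finset.erase_insert ha]
    have h1 : ∀ i ∈ T, f i * ee ((insert a T).erase i) f j
        = f i * ee (T.erase i) f j + f a * (f i * em (T.erase i) f j) := by
      intro i hi
      have hne : a ≠ i := fun h => ha (h ▸ hi)
      rw [Finset.erase_insert_of_ne hne]
      have hb : a ∉ T.erase i := fun h => ha (Finset.mem_of_mem_erase h)
      cases j with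
      | zero => simp [ee_zero, em]
      | succ j => rw [ee_insert hb]; simp only [em]; ring
    rw [Finset.sum_congr rfl h1, Finset.sum_add_distrib, ih, ← Finset.mul_sum, ee_insert ha]
    cases j with
    | zero => simp [em, ee_zero]; ring
    | succ j => simp only [em]; rw [ih]; push_cast; ring

lemma sum_erase (T : Finset ι) (f : ι → ℝ) (j : ℕ) :
    ∑ i ∈ T, ee (T.erase i) f j = (T.card - j) * ee T f j := by
  have h : ∑ i ∈ T, ee T f j = ∑ i ∈ T, (ee (T.erase i) f j + f i * em (T.erase i) f j) :=
    Finset.sum_congr rfl fun i hi => ee_erase' hi f j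
  rw [Finset.sum_add_distrib, Finset.sum_const, nsmul_eq_mul] at h
  have h2 : ∑ i ∈ T, f i * em (T.erase i) f j = j * ee T f j := by
    cases j with
    | zero => simp [em]
    | succ j => simp only [em]; rw [euler]; push_cast; ring
  rw [h2] at h; linarith

open Polynomial in
lemma newton (T : Finset ι) (f : ι → ℝ) (j : ℕ) :
    ee T f j * ee T f (j+2) ≤ ee T f (j+1) ^ 2 := by
  by_cases h : j + 2 ≤ T.card
  · have hs : (∏ i ∈ T, (X + C (f i)) : ℝ[X]).Splits :=
      Splits.prod fun i _ => Splits.X_add_C (f i)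
    have hn := newton_poly hs (T.card - (j+2))
    rw [Finset.prod_X_add_C_coeff _ _ (by omega), Finset.prod_X_add_C_coeff _ _ (by omega),
      Finset.prod_X_add_C_coeff _ _ (by omega)] at hn
    rw [show T.card - (T.card - (j+2)) = j+2 by omega,
      show T.card - (T.card - (j+2) + 1) = j+1 by omega,
      show T.card - (T.card - (j+2) + 2) = j by omega] at hn
    rw [mul_comm]; exact hn
  · have : ee T f (j+2) = 0 := by
      unfold ee
      rw [Finset.powersetCard_eq_empty.2 (by omega)]; simp
    rw [this, mul_zero]; positivity

/-- Garding cone -/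
def cone (T : Finset ι) (f : ι → ℝ) (k : ℕ) : Prop := ∀ j ≤ k, 0 < ee T f j

lemma cone_erase {T : Finset ι} {f : ι → ℝ} {k : ℕ} (h : cone T f (k+1)) {a : ι} (ha : a ∈ T) :
    cone (T.erase a) f k := by
  intro j
  induction j with
  | zero => intro _; rw [ee_zero]; norm_num
  | succ j ih =>
    intro hj
    have h0 := ih (by omega)
    by_contra hneg
    have h1 := h (j+1) (by omega)
    have h2 := h (j+2) (by omega)
    rw [ee_erase ha] at h1 h2
    have hN := newton (T.erase a) f j
    rw [show j + 1 + 1 = j + 2 from rfl] at h2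
    set x := ee (T.erase a) f j
    set y := ee (T.erase a) f (j+1)
    set z := ee (T.erase a) f (j+2)
    push Not at hneg
    nlinarith [mul_pos h0 h2, mul_nonneg (neg_nonneg.2 hneg) h1.le]

lemma lower {T : Finset ι} {f : ι → ℝ} (k : ℕ) (h : cone T f (k+1))
    (hle : ee T f k ≤ ee T f (k+1)) : 1 ≤ ee T f k := by
  induction k with
  | zero => rw [ee_zero]
  | succ k ih =>
    have hN := newton T f k
    have h1 := h (k+1) (by omega)
    have h0 := h k (by omega)
    have h3 : ee T f k ≤ ee T f (k+1) := by
      refine le_of_mul_le_mul_right ?_ h1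
      rw [show k + 1 + 1 = k + 2 from rfl] at hle
      nlinarith [mul_le_mul_of_nonneg_left hle h0.le]
    have := ih (fun j hj => h j (by omega)) h3
    linarith

lemma em_nonneg {T : Finset ι} {f : ι → ℝ} {k : ℕ} (h : cone T f k) : 0 ≤ em T f k := by
  cases k with
  | zero => simp [em]
  | succ k => exact (h k (by omega)).le

lemma neg_bound (N : ℕ) (K : ℝ) (hK : 0 ≤ K) (k : ℕ) :
    ∃ c : ℝ, 0 ≤ c ∧ ∀ (T : Finset ι) (f : ι → ℝ), T.card ≤ N → (∀ i ∈ T, -K ≤ f i) →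
      cone T f k → - ee T f (k+1) ≤ c * (K * ee T f k + K^2 * em T f k) := by
  induction k with
  | zero =>
    refine ⟨N, by positivity, fun T f hT hf _ => ?_⟩
    have h1 : ee T f 1 = ∑ i ∈ T, f i := by
      simpa [ee_zero] using (euler T f 0).symm
    have h2 : T.card • (-K) ≤ ∑ i ∈ T, f i := Finset.card_nsmul_le_sum T f (-K) hf
    rw [nsmul_eq_mul] at h2
    have h3 : (T.card : ℝ) ≤ N := by exact_mod_cast hT
    simp only [zero_add, h1, ee_zero, em]
    nlinarith
  | succ k ih =>
    obtain ⟨c, hc, ih⟩ := ih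
    refine ⟨N * (1 + N + c + 2 * c^2), by positivity, fun T f hT hf hcone => ?_⟩
    have hN : (T.card : ℝ) ≤ N := by exact_mod_cast hT
    have hE1 := hcone (k+1) le_rfl
    have hE0 := hcone k (by omega)
    simp only [em]
    set R := K * ee T f (k+1) + K^2 * ee T f k with hR
    have hA : 0 ≤ K * ee T f (k+1) := by positivity
    have hB : 0 ≤ K^2 * ee T f k := by positivity
    have hR0 : 0 ≤ R := by positivity
    have key : ∀ i ∈ T, f i * (- ee (T.erase i) f (k+1)) ≤ (1 + N + c + 2 * c^2) * R := by
      intro i hi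
      have hci := cone_erase hcone hi
      have hx := hci k le_rfl
      have hm := em_nonneg hci
      have e1 := ee_erase hi f k
      have e0 := ee_erase' hi f k
      have hfi := hf i hi
      by_cases hbig : K ≤ f i
      · have hi' := ih (T.erase i) f ((Finset.card_erase_le).trans hT)
          (fun j hj => hf j (Finset.mem_of_mem_erase hj)) hci
        have hf0 : 0 ≤ f i := hK.trans hbig
        set y := ee (T.erase i) f (k+1)
        set x := ee (T.erase i) f k
        set w := em (T.erase i) f k
        have hfw : 0 ≤ f i * w := mul_nonneg hf0 hm
        have hKw : K * w ≤ ee T f k := by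
          have := mul_le_mul_of_nonneg_right hbig hm
          linarith
        have hxE : x ≤ ee T f k := by linarith
        have s1 : K * (-y) ≤ 2 * c * (K^2 * ee T f k) := by
          have := mul_le_mul_of_nonneg_left hi' hK
          have t1 : c * K^2 * x ≤ c * K^2 * ee T f k :=
            mul_le_mul_of_nonneg_left hxE (by positivity)
          have t2 : c * K^2 * (K * w) ≤ c * K^2 * ee T f k :=
            mul_le_mul_of_nonneg_left hKw (by positivity)
          nlinarith
        have s2 : f i * (-y) ≤ c * (K * (f i * x) + K^2 * (f i * w)) := by
          have := mul_le_mul_of_nonneg_left hi' hf0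
          linarith
        have s3 : f i * x = ee T f (k+1) - y := by linarith
        have s4 : f i * w ≤ ee T f k := by linarith
        have s5 : c * (K^2 * (f i * w)) ≤ c * (K^2 * ee T f k) :=
          mul_le_mul_of_nonneg_left (mul_le_mul_of_nonneg_left s4 (by positivity)) hc
        have s6 := mul_le_mul_of_nonneg_left s1 hc
        rw [s3] at s2
        have s7 : f i * (-y) ≤ c * (K * ee T f (k+1)) + (2 * c^2 + c) * (K^2 * ee T f k) := by
          linarith
        have g1 : 0 ≤ (1 + N + 2 * c^2) * (K * ee T f (k+1)) := by positivity
        have g2 : 0 ≤ (1 + (N:ℝ)) * (K^2 * ee T f k) := by positivity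
        rw [hR]; linarith
      · push Not at hbig
        have habs : (f i)^2 ≤ K^2 := by nlinarith
        have hxN : ee (T.erase i) f k ≤ N * ee T f k := by
          have h1 := sum_erase T f k
          have h2 : ee (T.erase i) f k ≤ ∑ i ∈ T, ee (T.erase i) f k :=
            Finset.single_le_sum (f := fun i => ee (T.erase i) f k)
              (fun j hj => (cone_erase hcone hj k le_rfl).le) hi
          rw [h1] at h2
          have h3 : ((T.card : ℝ) - k) * ee T f k ≤ N * ee T f k :=
            mul_le_mul_of_nonneg_right (by linarith [(Nat.cast_nonneg k : (0:ℝ) ≤ k)]) hE0.le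
          linarith
        have s1 : f i * (- ee (T.erase i) f (k+1))
            = (-f i) * ee T f (k+1) + (f i)^2 * ee (T.erase i) f k := by rw [e1]; ring
        have s2 : (-f i) * ee T f (k+1) ≤ K * ee T f (k+1) :=
          mul_le_mul_of_nonneg_right (by linarith) hE1.le
        have s3 : (f i)^2 * ee (T.erase i) f k ≤ K^2 * (N * ee T f k) :=
          mul_le_mul habs hxN hx.le (by positivity)
        have g1 : 0 ≤ (N + c + 2 * c^2) * (K * ee T f (k+1)) := by positivity
        have g2 : 0 ≤ (1 + c + 2 * c^2) * (K^2 * ee T f k) := by positivity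
        rw [s1, hR]; linarith
    have hsum := Finset.sum_le_sum key
    rw [Finset.sum_const, nsmul_eq_mul] at hsum
    have heul := euler T f (k+1)
    simp only [mul_neg, Finset.sum_neg_distrib] at hsum
    rw [heul] at hsum
    have h5 : (T.card : ℝ) * ((1 + N + c + 2 * c^2) * R) ≤ N * ((1 + N + c + 2 * c^2) * R) :=
      mul_le_mul_of_nonneg_right hN (by positivity)
    by_cases hs : 0 ≤ ee T f (k+1+1)
    · have : 0 ≤ N * (1 + N + c + 2 * c^2) * R := by positivity
      linarith
    · push Not at hs
      have : 0 ≤ ((k+1 : ℕ) : ℝ) * (- ee T f (k+1+1)) :=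
        mul_nonneg (Nat.cast_nonneg _) (by linarith)
      linarith

lemma sigmaOn_cast {n : ℕ} (T : Finset (Fin n)) (j : ℕ) (lam : Fin n → ℝ) :
    sigmaOn T (j : ℤ) lam = ee T lam j := by
  simp [sigmaOn, ee]

/-- the vector `λ` with the extra entry `α` -/
def ext {n : ℕ} (α : ℝ) (lam : Fin n → ℝ) : Option (Fin n) → ℝ
  | none => α
  | some i => lam i

/-- index set with the extra entry -/
def exs {n : ℕ} (T : Finset (Fin n)) : Finset (Option (Fin n)) :=
  insert none (T.map Function.Embedding.some)

lemma ee_exs {n : ℕ} (T : Finset (Fin n)) (α : ℝ) (lam : Fin n → ℝ) (j : ℕ) :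
    ee (exs T) (ext α lam) (j+1) = ee T lam (j+1) + α * ee T lam j := by
  have h : ∀ j, ee (T.map Function.Embedding.some) (ext α lam) j = ee T lam j := by
    intro j
    simp [ee, Finset.powersetCard_map, Finset.sum_map, ext]
  unfold exs
  rw [ee_insert (by simp), h, h]
  rfl

lemma exs_erase {n : ℕ} (T : Finset (Fin n)) (p : Fin n) :
    (exs T).erase (some p) = exs (T.erase p) := by
  ext x
  cases x <;> simp [exs]

/-- The core estimate. -/
lemma core {K N₀ N₁ c : ℝ} (hK : 0 < K) (hN₀ : 0 < N₀) (hN₁ : 0 < N₁) (hc : 0 ≤ c)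
    {x a b d D S : ℝ} (hx1 : 1 ≤ x) (hx2 : 2 * c * K ≤ x) (hb : 0 < b) (hd : 0 < d)
    (hD : D = x * d + b) (hS : S = x * b + a) (hS1 : S ≤ N₁)
    (hH : -a ≤ c * (K * b + K^2 * d)) (hDl : min 1 N₀ ≤ D) :
    ((x + K) * b - S) * x
      ≤ ((K + c * K) * (2 * (N₁ / min 1 N₀) + 2 * c * K^2) + c * K^2) * D := by
  have hm : 0 < min 1 N₀ := lt_min one_pos hN₀
  have hNd : N₁ ≤ N₁ / min 1 N₀ * D := by
    rw [div_mul_eq_mul_div, le_div_iff₀ hm]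
    exact mul_le_mul_of_nonneg_left hDl hN₁.le
  have hxd : x * d ≤ D := by linarith
  have hdx : d ≤ x * d := by nlinarith
  have hcK : 0 ≤ c * K^2 := by positivity
  have h1 : c * K * b ≤ x / 2 * b := mul_le_mul_of_nonneg_right (by linarith) hb.le
  have h2 : x * b ≤ 2 * N₁ + 2 * (c * K^2 * d) := by nlinarith
  have h3 : c * K^2 * d ≤ c * K^2 * D := mul_le_mul_of_nonneg_left (by linarith) hcK
  have h4 : x * b ≤ (2 * (N₁ / min 1 N₀) + 2 * c * K^2) * D := by nlinarith
  have h5 : c * K^2 * (x * d) ≤ c * K^2 * D := mul_le_mul_of_nonneg_left hxd hcK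
  have h6 : x * (-a) ≤ c * K * (x * b) + c * K^2 * (x * d) := by
    have := mul_le_mul_of_nonneg_left hH (by linarith : (0:ℝ) ≤ x)
    linarith
  have h7 := mul_le_mul_of_nonneg_left h4 (by positivity : 0 ≤ K + c * K)
  have h8 : ((x + K) * b - S) * x = K * (x * b) + x * (-a) := by rw [hS]; ring
  rw [h8]
  linarith

end AbsAux


/-- **Absorption of the negative term by `B Σ S_k^{ii}`** (Lemma 3.4): for given
`C > 0` there are positive constants `m, A, B, M, L, Λ` such that for every
ordered `λ ∈ Γ_{k-1}` with `λ_n ≥ -K₀`, `N₀ ≤ S_k(λ) ≤ N₁` and `λ₁ ≥ Λ`,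
`(B/2) Σ_i S_k^{ii} + min{0, C[M²/(mL²) + A²/m + B²/(mλ₁²)](S_k − κ₁S_k^{11})λ₁} ≥ 0`,
where `κ₁ = λ₁ + K₀`. -/
theorem absorption_lemma
    {n k : ℕ} (hk : 2 ≤ k) (hkn : k ≤ n) (α K₀ N₀ N₁ C : ℝ)
    (hα : 0 < α) (hK₀ : 0 < K₀) (hN₀ : 0 < N₀) (hN₁ : 0 < N₁) (hC : 0 < C) :
    ∃ m A B M L Λ : ℝ,
      0 < m ∧ 0 < A ∧ 0 < B ∧ 0 < M ∧ 0 < L ∧ 0 < Λ ∧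
      ∀ lam ∈ GammaCone n (k - 1),
        (∀ i j : Fin n, i ≤ j → lam j ≤ lam i) →
        (∀ j : Fin n, -K₀ ≤ lam j) →
        N₀ ≤ Sfun α (k : ℤ) lam → Sfun α (k : ℤ) lam ≤ N₁ →
        Λ ≤ lam ⟨0, by omega⟩ →
        0 ≤ (B / 2) * (∑ i, SD α (k : ℤ) lam i)
            + min 0 (C * (M ^ 2 / (m * L ^ 2) + A ^ 2 / m
                  + B ^ 2 / (m * (lam ⟨0, by omega⟩) ^ 2))
                * (Sfun α (k : ℤ) lam
                    - (lam ⟨0, by omega⟩ + K₀) * SD α (k : ℤ) lam ⟨0, by omega⟩)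
                * lam ⟨0, by omega⟩) := by
  obtain ⟨r, rfl⟩ : ∃ r, k = r + 2 := ⟨k - 2, by omega⟩
  obtain ⟨c, hc, hneg⟩ := AbsAux.neg_bound (ι := Option (Fin n)) (n + 1) K₀ hK₀.le (r + 1)
  set C' : ℝ := (K₀ + c * K₀) * (2 * (N₁ / min 1 N₀) + 2 * c * K₀^2) + c * K₀^2 with hC'
  have hm : 0 < min 1 N₀ := lt_min one_pos hN₀
  have hC'pos : 0 < C' := by positivity
  refine ⟨6 * C * C', 1, 1, 1, 1, 1 + 2 * c * K₀, by positivity, one_pos, one_pos, one_pos, one_pos,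
    by positivity, ?_⟩
  intro lam hG hord hlow hS0 hS1 hL
  set p : Fin n := ⟨0, by omega⟩ with hp
  set μ := AbsAux.ext α lam with hμ
  set x := lam p with hxdef
  have hcK : 0 ≤ c * K₀ := by positivity
  have hx1 : 1 ≤ x := by linarith
  have hx2 : 2 * c * K₀ ≤ x := by linarith
  have hU : ∀ j : ℕ, AbsAux.ee (AbsAux.exs Finset.univ) μ (j+1)
      = AbsAux.ee Finset.univ lam (j+1) + α * AbsAux.ee Finset.univ lam j :=
    fun j => AbsAux.ee_exs _ _ _ _
  have hpos : ∀ j : ℕ, j ≤ r + 1 → 0 < AbsAux.ee Finset.univ lam j := by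
    intro j hj
    rcases Nat.eq_zero_or_pos j with rfl | h0
    · rw [AbsAux.ee_zero]; exact one_pos
    · have := hG j h0 (by omega)
      rwa [esymmR, AbsAux.sigmaOn_cast] at this
  have hSf : Sfun α ((r + 2 : ℕ) : ℤ) lam = AbsAux.ee (AbsAux.exs Finset.univ) μ (r + 2) := by
    rw [hU (r+1)]
    unfold Sfun esymmR
    rw [show ((r + 2 : ℕ) : ℤ) - 1 = ((r + 1 : ℕ) : ℤ) by push_cast; ring,
      AbsAux.sigmaOn_cast, AbsAux.sigmaOn_cast]
  have hSDi : ∀ i : Fin n, SD α ((r + 2 : ℕ) : ℤ) lam i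
      = AbsAux.ee (Finset.univ.erase i) lam (r+1) + α * AbsAux.ee (Finset.univ.erase i) lam r := by
    intro i
    unfold SD
    rw [show ((r + 2 : ℕ) : ℤ) - 1 = ((r + 1 : ℕ) : ℤ) by push_cast; ring,
      show ((r + 2 : ℕ) : ℤ) - 2 = ((r : ℕ) : ℤ) by push_cast; ring,
      AbsAux.sigmaOn_cast, AbsAux.sigmaOn_cast]
  have hmem : (some p) ∈ AbsAux.exs (Finset.univ : Finset (Fin n)) := by simp [AbsAux.exs]
  have hSDp : SD α ((r + 2 : ℕ) : ℤ) lam p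
      = AbsAux.ee ((AbsAux.exs Finset.univ).erase (some p)) μ (r+1) := by
    rw [hSDi, AbsAux.exs_erase, hμ, AbsAux.ee_exs]
  have hsum : AbsAux.ee (AbsAux.exs Finset.univ) μ (r+1)
      ≤ ∑ i, SD α ((r + 2 : ℕ) : ℤ) lam i := by
    rw [Finset.sum_congr rfl fun i _ => hSDi i, Finset.sum_add_distrib, ← Finset.mul_sum,
      AbsAux.sum_erase, AbsAux.sum_erase, hU, Finset.card_univ, Fintype.card_fin]
    have hn : (r : ℝ) + 2 ≤ n := by exact_mod_cast hkn
    have h1 := hpos (r+1) le_rfl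
    have h0 := hpos r (by omega)
    have g1 : 1 * AbsAux.ee Finset.univ lam (r+1)
        ≤ ((n:ℝ) - (r+1 : ℕ)) * AbsAux.ee Finset.univ lam (r+1) :=
      mul_le_mul_of_nonneg_right (by push_cast; linarith) h1.le
    have g0 : 1 * AbsAux.ee Finset.univ lam r ≤ ((n:ℝ) - r) * AbsAux.ee Finset.univ lam r :=
      mul_le_mul_of_nonneg_right (by linarith) h0.le
    have := mul_le_mul_of_nonneg_left g0 hα.le
    linarith
  have hcone : AbsAux.cone (AbsAux.exs Finset.univ) μ (r + 2) := by
    intro j hj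
    rcases Nat.eq_zero_or_pos j with rfl | h0
    · rw [AbsAux.ee_zero]; exact one_pos
    · rcases Nat.lt_or_ge j (r+2) with h2 | h2
      · obtain ⟨i, rfl⟩ : ∃ i, j = i + 1 := ⟨j - 1, by omega⟩
        rw [hU]
        have h3 := hpos (i+1) (by omega)
        have h4 := hpos i (by omega)
        positivity
      · obtain rfl : j = r + 2 := by omega
        rw [← hSf]; linarith
  have hcν := AbsAux.cone_erase hcone hmem
  have hH := hneg ((AbsAux.exs Finset.univ).erase (some p)) μ
    (by
      refine Finset.card_erase_le.trans ?_
      refine (Finset.card_insert_le _ _).trans ?_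
      simp)
    (by
      intro i _
      cases i with
      | none => show -K₀ ≤ α; linarith
      | some i => exact hlow i) hcν
  have hDl : min 1 N₀ ≤ AbsAux.ee (AbsAux.exs Finset.univ) μ (r+1) := by
    by_cases hle : AbsAux.ee (AbsAux.exs Finset.univ) μ (r+1)
        ≤ AbsAux.ee (AbsAux.exs Finset.univ) μ (r+2)
    · exact (min_le_left _ _).trans (AbsAux.lower (r+1) hcone hle)
    · push Not at hle
      rw [hSf] at hS0
      exact (min_le_right _ _).trans (by linarith)
  have eD := AbsAux.ee_erase hmem μ r
  have eS := AbsAux.ee_erase hmem μ (r+1)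
  have hcore := AbsAux.core hK₀ hN₀ hN₁ hc hx1 hx2 (hcν (r+1) le_rfl)
    (hcν r (by omega)) (eD.trans (add_comm _ _)) (hSf.trans (eS.trans (add_comm _ _))) hS1 hH hDl
  rw [← hSDp, ← hC'] at hcore
  set D := AbsAux.ee (AbsAux.exs Finset.univ) μ (r+1)
  set S := Sfun α ((r + 2 : ℕ) : ℤ) lam
  set s := SD α ((r + 2 : ℕ) : ℤ) lam p
  have hD0 : 0 < D := hm.trans_le hDl
  set q : ℝ := C * ((1:ℝ)^2 / (6 * C * C' * 1^2) + 1^2 / (6 * C * C') + 1^2 / (6 * C * C' * x^2))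
    with hq
  have hq0 : 0 ≤ q := by positivity
  have hq1 : q * C' ≤ 1 / 2 := by
    have hx0 : 0 < x := by linarith
    have e : q * C' = 1/6 + 1/6 + 1/6 * (1 / x^2) := by
      rw [hq]; field_simp
    have : 1 / x^2 ≤ 1 := by
      rw [div_le_one (by positivity)]; nlinarith
    rw [e]; linarith
  have hfin : -(D / 2) ≤ q * (S - (x + K₀) * s) * x := by
    have h1 := mul_le_mul_of_nonneg_left hcore hq0
    have h2 := mul_le_mul_of_nonneg_right hq1 hD0.le
    linarith
  have hmin : -(D / 2) ≤ min 0 (q * (S - (x + K₀) * s) * x) := le_min (by linarith) hfin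
  linarith
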